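/- arXiv:2312.12616 — 5 statements merged into one kernel-verified Lean document; each statement's English description precedes it below -/
import Mathlib

section
/- Let (Z, 𝒵) be a measurable space and K a Markov kernel on Z. Suppose K satisfies a Doeblin minorization condition: there exists a nonzero finite measure ν₁ on (Z, 𝒵) such that K(z, A) ≥ ν₁(A) for every z ∈ Z and A ∈ 𝒵. Then K admits a unique invariant probability measure, i.e., there exists exactly one probability measure π on (Z, 𝒵) such that π(A) = ∫ K(z, A) π(dz) for all A ∈ 𝒵. -/
open MeasureTheory ProbabilityTheory
open scoped ENNReal

namespace ProbabilityTheory.Kernel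

variable {α β : Type*} {mα : MeasurableSpace α} {mβ : MeasurableSpace β}

/-- A finite measure lying below every measure of a kernel splits off as a constant kernel. -/
lemma exists_eq_add_const_of_forall_le (K : Kernel α β) (ν : Measure β) [IsFiniteMeasure ν]
    (h : ∀ a, ν ≤ K a) : ∃ R : Kernel α β, K = R + Kernel.const α ν := by
  refine ⟨⟨fun a ↦ K a - ν, Measure.measurable_of_measurable_coe _ fun s hs ↦ ?_⟩, ?_⟩
  · simp_rw [Measure.sub_apply hs (h _)]
    exact (K.measurable_coe hs).sub_const _
  · ext1 a
    exact (Measure.sub_add_cancel_of_le (h a)).symm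

/-- The total masses of the iterates of a measure under a kernel of constant mass `r`. -/
lemma iterate_bind_apply_univ (R : Kernel α α) (ν : Measure α) {r : ℝ≥0∞}
    (hR : ∀ a, R a Set.univ = r) (n : ℕ) :
    (fun μ : Measure α ↦ μ.bind R)^[n] ν Set.univ = ν Set.univ * r ^ n := by
  induction n with
  | zero => simp
  | succ n ih =>
    rw [Function.iterate_succ_apply', Measure.bind_apply .univ R.aemeasurable]
    simp_rw [hR]
    rw [MeasureTheory.lintegral_const, ih, pow_succ]
    ring

/-- The Neumann series `∑ n, ν Rⁿ` solves the fixed-point equation `μ = μ R + ν`. -/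
lemma sum_iterate_bind_eq (R : Kernel α α) (ν : Measure α) :
    (Measure.sum fun n ↦ (fun μ : Measure α ↦ μ.bind R)^[n] ν).bind R + ν =
      Measure.sum fun n ↦ (fun μ : Measure α ↦ μ.bind R)^[n] ν := by
  rw [Measure.bind_sum _ _ R.aemeasurable]
  ext s hs
  rw [Measure.add_apply, Measure.sum_apply _ hs, Measure.sum_apply _ hs, add_comm]
  conv_rhs => rw [tsum_eq_zero_add' ENNReal.summable]
  simp_rw [Function.iterate_succ_apply', Function.iterate_zero_apply]

/-- The Neumann series `∑ n, ν Rⁿ` is the least solution of `μ = μ R + ν`. -/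
lemma sum_iterate_bind_le {R : Kernel α α} {ν μ : Measure α} (h : μ.bind R + ν = μ) :
    Measure.sum (fun n ↦ (fun μ : Measure α ↦ μ.bind R)^[n] ν) ≤ μ := by
  set f : Measure α → Measure α := fun μ ↦ μ.bind R with hf
  have hadd (n : ℕ) (ξ η : Measure α) : f^[n] (ξ + η) = f^[n] ξ + f^[n] η := by
    induction n with
    | zero => rfl
    | succ n ih =>
      simp only [Function.iterate_succ_apply', ih]
      exact Measure.comp_add
  have hpart (n : ℕ) : μ = f^[n] μ + ∑ k ∈ Finset.range n, f^[k] ν := by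
    induction n with
    | zero => simp
    | succ n ih =>
      have hiter : f^[n] μ = f^[n + 1] μ + f^[n] ν := by
        rw [Function.iterate_succ_apply, ← hadd, hf, h]
      rw [Finset.sum_range_succ, add_comm (Finset.sum _ _), ← add_assoc, ← hiter]
      exact ih
  refine Measure.le_iff.2 fun s hs ↦ ?_
  rw [Measure.sum_apply _ hs, ENNReal.tsum_eq_iSup_nat]
  refine iSup_le fun n ↦ ?_
  conv_rhs => rw [hpart n]
  rw [Measure.add_apply, Measure.finsetSum_apply]
  exact le_add_self

end ProbabilityTheory.Kernel

/-- A Markov kernel satisfying a Doeblin minorization condition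
(with a nonzero finite minorizing measure) admits a unique invariant probability
measure. -/
theorem doeblin_exists_unique_invariant_measure
    {Z : Type*} [MeasurableSpace Z] (K : Kernel Z Z) [IsMarkovKernel K]
    (ν₁ : Measure Z) [IsFiniteMeasure ν₁] (hν : ν₁ ≠ 0)
    (hmin : ∀ (z : Z) (A : Set Z), MeasurableSet A → ν₁ A ≤ K z A) :
    ∃! π : Measure Z, IsProbabilityMeasure π ∧
      ∀ A : Set Z, MeasurableSet A → π A = ∫⁻ z, K z A ∂π := by
  obtain ⟨R, hR⟩ := K.exists_eq_add_const_of_forall_le ν₁ fun z ↦ Measure.le_iff.2 (hmin z)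
  have hinv (π : Measure Z) [IsProbabilityMeasure π] :
      (∀ A : Set Z, MeasurableSet A → π A = ∫⁻ z, K z A ∂π) ↔ π.bind R + ν₁ = π := by
    have hK : π.bind K = π.bind R + ν₁ := by
      rw [hR, Measure.add_comp]
      simp [Kernel.const]
    rw [← hK, eq_comm, Measure.ext_iff]
    exact forall₂_congr fun A hA ↦ by rw [Measure.bind_apply hA K.aemeasurable]
  obtain ⟨z⟩ : Nonempty Z := by
    by_contra h
    rw [not_nonempty_iff] at h
    exact hν (Measure.eq_zero_of_isEmpty ν₁)
  have hmass (z : Z) : R z Set.univ = 1 - ν₁ Set.univ := by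
    have h : R z Set.univ + ν₁ Set.univ = 1 := by
      rw [← measure_univ (μ := K z), hR]
      simp
    exact ENNReal.eq_sub_of_add_eq (measure_ne_top _ _) h
  have hle : ν₁ Set.univ ≤ 1 := (hmin z _ .univ).trans_eq measure_univ
  have hprob : IsProbabilityMeasure
      (Measure.sum fun n ↦ (fun μ : Measure Z ↦ μ.bind R)^[n] ν₁) := by
    refine ⟨?_⟩
    rw [Measure.sum_apply _ .univ]
    simp_rw [Kernel.iterate_bind_apply_univ R ν₁ hmass]
    rw [ENNReal.tsum_mul_left, ENNReal.tsum_geometric,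
      ENNReal.sub_sub_cancel ENNReal.one_ne_top hle]
    exact ENNReal.mul_inv_cancel (by simpa using hν) (measure_ne_top _ _)
  refine ⟨_, ⟨hprob, (hinv _).2 (R.sum_iterate_bind_eq ν₁)⟩, ?_⟩
  rintro π ⟨_, hπ⟩
  exact (Measure.eq_of_le_of_isProbabilityMeasure
    (Kernel.sum_iterate_bind_le ((hinv π).1 hπ))).symm
end

section
/- Let Θ be a real normed vector space, let 0 < ε < 1 and κ̃ ≥ 1, let N ∈ ℕ with N ≥ 1, and let w¹, …, w^N : Θ → ℝ be differentiable functions such that for all i and all θ, θ' ∈ Θ: wⁱ(θ) ≥ ε³, ‖Dwⁱ(θ)‖ ≤ κ̃, |wⁱ(θ) − wⁱ(θ')| ≤ κ̃‖θ − θ'‖, and ‖Dwⁱ(θ) − Dwⁱ(θ')‖ ≤ κ̃‖θ − θ'‖. Then the Fréchet derivative of G(θ) := log(∑_{i=1}^N wⁱ(θ)) satisfies ‖DG(θ) − DG(θ')‖ ≤ (κ̃/ε³ + κ̃²/ε⁶)·‖θ − θ'‖ for all θ, θ' ∈ Θ. -/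
/-- Quantitative continuity of `(a, x) ↦ a⁻¹ • x` away from `a = 0`. -/
theorem norm_inv_smul_sub_inv_smul_le {E : Type*} [SeminormedAddCommGroup E] [NormedSpace ℝ E]
    {a b c L M K : ℝ} {x y : E} (hc : 0 < c) (ha : c ≤ a) (hb : c ≤ b)
    (hxy : ‖x - y‖ ≤ L) (hab : |a - b| ≤ M) (hy : ‖y‖ ≤ K) :
    ‖a⁻¹ • x - b⁻¹ • y‖ ≤ L / c + M * K / c ^ 2 := by
  have ha0 : 0 < a := hc.trans_le ha
  have hb0 : 0 < b := hc.trans_le hb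
  have hL : 0 ≤ L := (norm_nonneg _).trans hxy
  have hM : 0 ≤ M := (abs_nonneg _).trans hab
  have hK : 0 ≤ K := (norm_nonneg _).trans hy
  have hsplit : a⁻¹ • x - b⁻¹ • y = a⁻¹ • (x - y) + (a⁻¹ - b⁻¹) • y := by module
  have hinv : |a⁻¹ - b⁻¹| ≤ M / c ^ 2 := by
    rw [inv_sub_inv ha0.ne' hb0.ne', abs_div, abs_sub_comm, abs_of_pos (mul_pos ha0 hb0), sq]
    gcongr
  calc ‖a⁻¹ • x - b⁻¹ • y‖
      ≤ ‖a⁻¹ • (x - y)‖ + ‖(a⁻¹ - b⁻¹) • y‖ := hsplit ▸ norm_add_le _ _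
    _ = ‖x - y‖ / a + |a⁻¹ - b⁻¹| * ‖y‖ := by
      rw [norm_smul, norm_smul, Real.norm_eq_abs, Real.norm_eq_abs, abs_of_pos (inv_pos.2 ha0),
        inv_mul_eq_div]
    _ ≤ L / c + M / c ^ 2 * K := by gcongr
    _ = L / c + M * K / c ^ 2 := by ring

/-- If the `N` weight functions `wⁱ` are differentiable, bounded
below by `ε³`, have derivatives bounded by `κ̃`, are `κ̃`-Lipschitz and have
`κ̃`-Lipschitz derivatives, then the derivative of `G(θ) = log ∑ᵢ wⁱ(θ)` satisfies
`‖DG(θ) − DG(θ')‖ ≤ (κ̃/ε³ + κ̃²/ε⁶)‖θ − θ'‖`. -/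
theorem log_sum_weights_gradient_lipschitz
    {Θ : Type*} [NormedAddCommGroup Θ] [NormedSpace ℝ Θ]
    (ε κt : ℝ) (hε0 : 0 < ε) (hε1 : ε < 1) (hκ : 1 ≤ κt)
    (N : ℕ) (hN : 1 ≤ N) (w : Fin N → Θ → ℝ)
    (hdiff : ∀ i, Differentiable ℝ (w i))
    (hlb : ∀ i θ, ε ^ 3 ≤ w i θ)
    (hD : ∀ i θ, ‖fderiv ℝ (w i) θ‖ ≤ κt)
    (hL : ∀ i θ θ', |w i θ - w i θ'| ≤ κt * ‖θ - θ'‖)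
    (hDL : ∀ i θ θ', ‖fderiv ℝ (w i) θ - fderiv ℝ (w i) θ'‖ ≤ κt * ‖θ - θ'‖) :
    ∀ θ θ' : Θ,
      ‖fderiv ℝ (fun θ => Real.log (∑ i, w i θ)) θ -
          fderiv ℝ (fun θ => Real.log (∑ i, w i θ)) θ'‖ ≤
        (κt / ε ^ 3 + κt ^ 2 / ε ^ 6) * ‖θ - θ'‖ := by
  intro θ θ'
  have hNpos : (0 : ℝ) < N := by exact_mod_cast hN
  have hlower (η : Θ) : N * ε ^ 3 ≤ ∑ i, w i η := by
    simpa using Finset.card_nsmul_le_sum Finset.univ (fun i => w i η) _ fun i _ => hlb i η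
  have hcpos : 0 < N * ε ^ 3 := by positivity
  have hfderiv (η : Θ) : fderiv ℝ (fun θ => Real.log (∑ i, w i θ)) η =
      (∑ i, w i η)⁻¹ • ∑ i, fderiv ℝ (w i) η :=
    ((HasFDerivAt.fun_sum fun i _ => (hdiff i η).hasFDerivAt).log
      (hcpos.trans_le (hlower η)).ne').fderiv
  have hsub : ‖∑ i, fderiv ℝ (w i) θ - ∑ i, fderiv ℝ (w i) θ'‖ ≤ N * (κt * ‖θ - θ'‖) := by
    rw [← Finset.sum_sub_distrib]
    simpa using norm_sum_le_of_le Finset.univ fun i _ => hDL i θ θ'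
  have habs : |∑ i, w i θ - ∑ i, w i θ'| ≤ N * (κt * ‖θ - θ'‖) := by
    rw [← Finset.sum_sub_distrib]
    refine (Finset.abs_sum_le_sum_abs _ _).trans ?_
    simpa using Finset.sum_le_sum (s := Finset.univ) fun i _ => hL i θ θ'
  have hnorm : ‖∑ i, fderiv ℝ (w i) θ'‖ ≤ N * κt := by
    simpa using norm_sum_le_of_le Finset.univ fun i _ => hD i θ'
  rw [hfderiv, hfderiv]
  refine (norm_inv_smul_sub_inv_smul_le hcpos (hlower θ) (hlower θ') hsub habs hnorm).trans_eq ?_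
  field_simp
end

section
/- Let Θ be a real normed vector space, let 0 < ε < 1 and κ̃ ≥ 1, let N ∈ ℕ with N ≥ 1, and let w¹, …, w^N : Θ → ℝ be functions such that for all ℓ and all θ, θ' ∈ Θ: ε³ ≤ w^ℓ(θ) ≤ ε⁻³ and |w^ℓ(θ) − w^ℓ(θ')| ≤ κ̃‖θ − θ'‖. Then for every choice of indices i₁, …, i_N ∈ {1, …, N} and all θ, θ' ∈ Θ, the product of self-normalized weights satisfies | ∏_{j=1}^N ( w^{i_j}(θ)/∑_{ℓ=1}^N w^ℓ(θ) ) − ∏_{j=1}^N ( w^{i_j}(θ')/∑_{ℓ=1}^N w^ℓ(θ') ) | ≤ (κ̃ N / (N^N ε^{6N−3}))·(1 + ε⁻⁶)·‖θ − θ'‖. -/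
/-- Telescoping bound for the difference of two finite products of nonnegative reals bounded
by `M` whose factors are pairwise within `δ`. -/
theorem mul_abs_prod_sub_prod_le {α : Type*} (s : Finset α) (a b : α → ℝ) {M δ : ℝ}
    (ha0 : ∀ j, 0 ≤ a j) (ha : ∀ j, a j ≤ M) (hb0 : ∀ j, 0 ≤ b j) (hb : ∀ j, b j ≤ M)
    (hM : 0 ≤ M) (hab : ∀ j, |a j - b j| ≤ δ) :
    M * |∏ j ∈ s, a j - ∏ j ∈ s, b j| ≤ s.card * M ^ s.card * δ := by
  classical
  induction s using Finset.induction_on with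
  | empty => simp
  | insert x s hx ih =>
    rw [Finset.prod_insert hx, Finset.prod_insert hx, Finset.card_insert_of_notMem hx]
    set P := ∏ j ∈ s, a j
    set Q := ∏ j ∈ s, b j
    have hQ0 : 0 ≤ Q := Finset.prod_nonneg fun j _ => hb0 j
    have hQ : Q ≤ M ^ s.card := by
      simpa using Finset.prod_le_prod (s := s) (fun j _ => hb0 j) fun j _ => hb j
    have hδ : 0 ≤ δ := (abs_nonneg _).trans (hab x)
    have hsplit : |a x * P - b x * Q| ≤ a x * |P - Q| + |a x - b x| * Q := by
      calc |a x * P - b x * Q| = |a x * (P - Q) + (a x - b x) * Q| := by ring_nf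
        _ ≤ |a x * (P - Q)| + |(a x - b x) * Q| := abs_add_le _ _
        _ = _ := by rw [abs_mul, abs_mul, abs_of_nonneg (ha0 x), abs_of_nonneg hQ0]
    calc M * |a x * P - b x * Q| ≤ M * (a x * |P - Q| + |a x - b x| * Q) := by gcongr
      _ = a x * (M * |P - Q|) + M * (|a x - b x| * Q) := by ring
      _ ≤ M * (s.card * M ^ s.card * δ) + M * (δ * M ^ s.card) := by
          gcongr
          · exact ha x
          · exact hab x
      _ = _ := by push_cast; ring

/-- A quotient `u / S` whose perturbation is small in numerator and denominator. -/
theorem abs_div_sub_div_le {u v S T c d e M : ℝ} (hc : 0 < c) (hS : c ≤ S) (hT : 0 < T)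
    (huv : |u - v| ≤ d) (hST : |S - T| ≤ e) (hv : 0 ≤ v) (hM : v / T ≤ M) :
    |u / S - v / T| ≤ (d + M * e) / c := by
  have hS0 : 0 < S := hc.trans_le hS
  have hvT : 0 ≤ v / T := div_nonneg hv hT.le
  have hd : 0 ≤ d := (abs_nonneg _).trans huv
  have he : 0 ≤ e := (abs_nonneg _).trans hST
  have hM0 : 0 ≤ M := hvT.trans hM
  calc |u / S - v / T| = |((u - v) - v / T * (S - T)) / S| := by
        congr 1; field_simp; ring
    _ = |(u - v) - v / T * (S - T)| / S := by rw [abs_div, abs_of_pos hS0]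
    _ ≤ (|u - v| + v / T * |S - T|) / S := by
        gcongr
        refine (abs_sub _ _).trans_eq ?_
        rw [abs_mul, abs_of_nonneg hvT]
    _ ≤ (d + M * e) / c := by gcongr

/-- If the `N` weight functions `w^ℓ` take values in `[ε³, ε⁻³]`
and are `κ̃`-Lipschitz, then for any ancestor-index vector `(i₁, …, i_N)` the
product of self-normalized weights is Lipschitz with constant
`(κ̃N/(N^N ε^{6N−3}))(1 + ε⁻⁶)`. -/
theorem product_self_normalized_weights_lipschitz
    {Θ : Type*} [NormedAddCommGroup Θ] [NormedSpace ℝ Θ]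
    (ε κt : ℝ) (hε0 : 0 < ε) (hε1 : ε < 1) (hκ : 1 ≤ κt)
    (N : ℕ) (hN : 1 ≤ N) (w : Fin N → Θ → ℝ)
    (hlb : ∀ ℓ θ, ε ^ 3 ≤ w ℓ θ) (hub : ∀ ℓ θ, w ℓ θ ≤ (ε ^ 3)⁻¹)
    (hL : ∀ ℓ θ θ', |w ℓ θ - w ℓ θ'| ≤ κt * ‖θ - θ'‖) :
    ∀ (ι : Fin N → Fin N) (θ θ' : Θ),
      |(∏ j, w (ι j) θ / ∑ ℓ, w ℓ θ) - ∏ j, w (ι j) θ' / ∑ ℓ, w ℓ θ'| ≤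
        κt * N / ((N : ℝ) ^ N * ε ^ (6 * N - 3)) * (1 + (ε ^ 6)⁻¹) * ‖θ - θ'‖ := by
  intro ι θ θ'
  have hN0 : (0 : ℝ) < N := by exact_mod_cast hN
  have hw0 : ∀ ℓ θ, 0 ≤ w ℓ θ := fun ℓ θ => (pow_pos hε0 3).le.trans (hlb ℓ θ)
  have hc : 0 < (N : ℝ) * ε ^ 3 := by positivity
  have hS : ∀ θ, (N : ℝ) * ε ^ 3 ≤ ∑ ℓ, w ℓ θ := fun θ => by
    simpa using Finset.sum_le_sum fun ℓ (_ : ℓ ∈ Finset.univ) => hlb ℓ θ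
  have hSL : |∑ ℓ, w ℓ θ - ∑ ℓ, w ℓ θ'| ≤ N * (κt * ‖θ - θ'‖) := by
    rw [← Finset.sum_sub_distrib]
    refine (Finset.abs_sum_le_sum_abs _ _).trans ?_
    simpa using Finset.sum_le_sum fun ℓ (_ : ℓ ∈ Finset.univ) => hL ℓ θ θ'
  have hfac0 : ∀ ℓ θ, 0 ≤ w ℓ θ / ∑ k, w k θ := fun ℓ θ =>
    div_nonneg (hw0 ℓ θ) (hc.le.trans (hS θ))
  have hfac : ∀ ℓ θ, w ℓ θ / ∑ k, w k θ ≤ (N * ε ^ 6)⁻¹ := fun ℓ θ => by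
    calc w ℓ θ / ∑ k, w k θ ≤ (ε ^ 3)⁻¹ / (N * ε ^ 3) :=
          div_le_div₀ (by positivity) (hub ℓ θ) hc (hS θ)
      _ = (N * ε ^ 6)⁻¹ := by field_simp
  have hM : 0 < ((N : ℝ) * ε ^ 6)⁻¹ := by positivity
  have key := mul_abs_prod_sub_prod_le Finset.univ
    (fun j => w (ι j) θ / ∑ ℓ, w ℓ θ) (fun j => w (ι j) θ' / ∑ ℓ, w ℓ θ')
    (fun j => hfac0 _ _) (fun j => hfac _ _) (fun j => hfac0 _ _) (fun j => hfac _ _) hM.le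
    (fun j => abs_div_sub_div_le hc (hS θ) (hc.trans_le (hS θ')) (hL (ι j) θ θ') hSL
      (hw0 _ _) (hfac _ _))
  rw [Finset.card_univ, Fintype.card_fin] at key
  refine le_of_mul_le_mul_left (key.trans_eq ?_) hM
  obtain ⟨n, rfl⟩ : ∃ n, N = n + 1 := ⟨N - 1, by omega⟩
  have hexp : 6 * (n + 1) - 3 = 6 * n + 3 := by omega
  rw [hexp, inv_pow, mul_pow, ← pow_mul]
  generalize ((n + 1 : ℕ) : ℝ) = m at hN0 ⊢
  field_simp
  ring
end

section
/- Let (Z, 𝒵) be a measurable space, K a Markov kernel on Z with invariant probability measure π, let d ∈ ℕ with d ≥ 1, and let g : Z → ℝ^d be a bounded measurable function. Suppose there are constants α ≥ 1 and ρ ∈ (0, 1) such that ‖Kˢ g(z) − ∫ g dπ‖ ≤ α ρˢ for every z ∈ Z and s ∈ ℕ. Then the function ĥ(z) := ∑_{s=0}^∞ (Kˢ g(z) − ∫ g dπ) is well defined (the series converges absolutely for every z), it satisfies ‖ĥ(z)‖ ≤ α/(1 − ρ) for every z ∈ Z, and it solves the Poisson equation: g(z) − ∫ g dπ = ĥ(z)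 − Kĥ(z) for every z ∈ Z, where Kĥ(z) := ∫ ĥ(z') K(z, dz'). -/
open MeasureTheory ProbabilityTheory

/-- The action of a kernel on a (bounded measurable) function:
`kernelOp K f z = ∫ f(z') K(z, dz')` (Bochner integral). -/
noncomputable def kernelOp {Z : Type*} [MeasurableSpace Z] {E : Type*}
    [NormedAddCommGroup E] [NormedSpace ℝ E]
    (K : Kernel Z Z) (f : Z → E) (z : Z) : E :=
  ∫ z', f z' ∂(K z)

/-- The iterated action of a kernel on functions preserves strong measurability. -/
lemma stronglyMeasurable_kernelOp_iterate {Z E : Type*} [MeasurableSpace Z]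
    [NormedAddCommGroup E] [NormedSpace ℝ E] (K : Kernel Z Z) [IsSFiniteKernel K]
    {f : Z → E} (hf : StronglyMeasurable f) (s : ℕ) :
    StronglyMeasurable ((kernelOp K)^[s] f) := by
  induction s with
  | zero => exact hf
  | succ s ih =>
    rw [Function.iterate_succ_apply']
    exact ih.integral_kernel

/-- If the sequence `Kˢ f - c` is dominated, uniformly in the point, by a summable sequence,
then its sum solves the Poisson equation. -/
lemma sub_eq_tsum_sub_kernelOp_tsum {Z E : Type*} [MeasurableSpace Z]
    [NormedAddCommGroup E] [NormedSpace ℝ E] [CompleteSpace E]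
    (K : Kernel Z Z) [IsMarkovKernel K] {f : Z → E} (hf : StronglyMeasurable f) (c : E)
    {b : ℕ → ℝ} (hb : Summable b) (hfb : ∀ z s, ‖(kernelOp K)^[s] f z - c‖ ≤ b s) (z : Z) :
    f z - c = (∑' s : ℕ, ((kernelOp K)^[s] f z - c)) -
      kernelOp K (fun z' => ∑' s : ℕ, ((kernelOp K)^[s] f z' - c)) z := by
  have hint (s : ℕ) : Integrable (fun z' => (kernelOp K)^[s] f z' - c) (K z) :=
    .of_bound
      ((stronglyMeasurable_kernelOp_iterate K hf s).sub stronglyMeasurable_const).aestronglyMeasurable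
      (b s) (.of_forall fun z' => hfb z' s)
  have hnorm : Summable fun s : ℕ => ∫ z', ‖(kernelOp K)^[s] f z' - c‖ ∂(K z) := by
    refine hb.of_nonneg_of_le (fun s => integral_nonneg fun _ => norm_nonneg _) fun s => ?_
    calc ∫ z', ‖(kernelOp K)^[s] f z' - c‖ ∂(K z) ≤ ∫ _, b s ∂(K z) :=
          integral_mono (hint s).norm (integrable_const _) fun z' => hfb z' s
      _ = b s := by simp
  have hstep (s : ℕ) :
      ∫ z', ((kernelOp K)^[s] f z' - c) ∂(K z) = (kernelOp K)^[s + 1] f z - c := by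
    have hs : Integrable ((kernelOp K)^[s] f) (K z) :=
      ((hint s).add (integrable_const c)).congr (.of_forall fun _ => sub_add_cancel _ _)
    rw [integral_sub hs (integrable_const c), Function.iterate_succ_apply']
    simp [kernelOp]
  have hsum : Summable fun s : ℕ => (kernelOp K)^[s] f z - c :=
    .of_norm_bounded hb (hfb z)
  have hK : kernelOp K (fun z' => ∑' s : ℕ, ((kernelOp K)^[s] f z' - c)) z =
      ∑' s : ℕ, ((kernelOp K)^[s + 1] f z - c) := by
    simp_rw [← hstep]
    exact (hasSum_integral_of_summable_integral_norm hint hnorm).tsum_eq.symm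
  rw [hK, hsum.tsum_eq_zero_add]
  simp

/-- (Existence of a bounded solution to the Poisson equation.)
If `‖Kˢg(z) − π(g)‖ ≤ αρˢ`, then `ĥ(z) := ∑ₛ (Kˢg(z) − π(g))` converges
absolutely, is bounded by `α/(1 − ρ)` and solves the Poisson equation
`g − π(g) = ĥ − Kĥ`. -/
theorem poisson_equation_solution
    {Z : Type*} [MeasurableSpace Z] (K : Kernel Z Z) [IsMarkovKernel K]
    (π : Measure Z) [IsProbabilityMeasure π]
    (hinv : ∀ A : Set Z, MeasurableSet A → π A = ∫⁻ z, K z A ∂π)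
    (d : ℕ) (hd : 1 ≤ d)
    (g : Z → EuclideanSpace ℝ (Fin d)) (hgm : Measurable g)
    (hgbd : ∃ M, ∀ z, ‖g z‖ ≤ M)
    (α ρ : ℝ) (hα : 1 ≤ α) (hρ0 : 0 < ρ) (hρ1 : ρ < 1)
    (hgeo : ∀ (z : Z) (s : ℕ), ‖(kernelOp K)^[s] g z - ∫ x, g x ∂π‖ ≤ α * ρ ^ s) :
    (∀ z, Summable fun s : ℕ => ‖(kernelOp K)^[s] g z - ∫ x, g x ∂π‖) ∧
      (∀ z, ‖∑' s : ℕ, ((kernelOp K)^[s] g z - ∫ x, g x ∂π)‖ ≤ α / (1 - ρ)) ∧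
      ∀ z, g z - ∫ x, g x ∂π =
        (∑' s : ℕ, ((kernelOp K)^[s] g z - ∫ x, g x ∂π)) -
          kernelOp K (fun z' => ∑' s : ℕ, ((kernelOp K)^[s] g z' - ∫ x, g x ∂π)) z := by
  have hsum : HasSum (fun s : ℕ => α * ρ ^ s) (α / (1 - ρ)) := by
    simpa [div_eq_mul_inv] using (hasSum_geometric_of_lt_one hρ0.le hρ1).mul_left α
  exact ⟨fun z => hsum.summable.of_nonneg_of_le (fun _ => norm_nonneg _) (hgeo z),
    fun z => tsum_of_norm_bounded hsum (hgeo z),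
    sub_eq_tsum_sub_kernelOp_tsum K hgm.stronglyMeasurable _ hsum.summable hgeo⟩
end

section
/- Let (Ω, ℱ, P) be a probability space with filtration (ℱ_t)_{t∈ℕ}, (Z, 𝒵) a measurable space, d ∈ ℕ with d ≥ 1, and for each θ ∈ ℝ^d let T_θ be a Markov kernel on Z. Let g : ℝ^d × Z → ℝ^d be measurable, let (γ_t)_{t≥1} be positive step sizes, and let (Z_t)_{t∈ℕ} and (θ_t)_{t∈ℕ} be processes such that Z_t and θ_t are ℱ_t-measurable, θ_{t+1} = θ_t + γ_{t+1} g(θ_t, Z_{t+1}) for all t, and for every bounded measurable f : Z → ℝ and every t, E[f(Z_{t+1}) | ℱ_t] = (T_{θ_t} f)(Z_t) almost surely. Let h : ℝ^d → ℝ^d and suppose there exist: a bounded differentiable function V : ℝ^d → ℝ with gradient ∇V = h; a constant α̃ ≥ 1 and a measurable function ĥ : ℝ^d × Z → ℝ^d such that for all θ, θ' ∈ ℝ^d and z ∈ Z: (i) g(θ, z) − h(θ) = ĥ(θ, z) − (T_θ ĥ(θ, ·))(z) (Poisson equation); (ii) ‖g(θ, z)‖ ≤ α̃, ‖ĥ(θ,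 z)‖ ≤ α̃, ‖(T_θ ĥ(θ, ·))(z)‖ ≤ α̃; (iii) ‖g(θ, z) − g(θ', z)‖ ≤ α̃‖θ − θ'‖, ‖(T_θ ĥ(θ, ·))(z) − (T_{θ'} ĥ(θ', ·))(z)‖ ≤ α̃‖θ − θ'‖, and ‖h(θ) − h(θ')‖ ≤ α̃‖θ − θ'‖. Suppose further there exist a > 0 and a' > 0 such that for all t ≥ 1: γ_{t+1} ≤ γ_t, γ_t ≤ a γ_{t+1}, γ_t − γ_{t+1} ≤ a' γ_{t+1}², and γ_1 ≤ 1/(2α̃ + 2c_h), where c_h := α̃(a + 1)/2 + α̃²(2a + 1) + α̃ a'. Then, with c_γ := α̃²(2 + α̃), for every t ∈ ℕ: ∑_{s=0}^{t} γ_{s+1} E[‖h(θ_s)‖²] ≤ 2·( E[V(θ_{t+1}) − V(θ_0)] + α̃(γ_1 − γ_{t+1} + 2) + (4α̃³ + c_γ) ∑_{s=0}^{t} γ_{s+1}² ). -/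
open MeasureTheory ProbabilityTheory

/-- First-order lower bound for a function whose gradient is `L`-Lipschitz. -/
theorem add_inner_sub_le_of_gradient_lipschitz {E : Type*} [NormedAddCommGroup E]
    [InnerProductSpace ℝ E] [CompleteSpace E] {V : E → ℝ} {h : E → E} {L : ℝ}
    (hV : Differentiable ℝ V) (hVh : ∀ x, gradient V x = h x)
    (hL : ∀ x y, ‖h x - h y‖ ≤ L * ‖x - y‖) (hL0 : 0 ≤ L) (x y : E) :
    V x + inner ℝ (h x) (y - x) - L * ‖y - x‖ ^ 2 ≤ V y := by
  obtain ⟨c, hc, hc'⟩ := domain_mvt (f := V) (s := Set.univ) (x := x) (y := y)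
    (f' := fun z => InnerProductSpace.toDual ℝ E (h z))
    (fun z _ => by
      have := (hV z).hasGradientAt
      rw [hVh] at this
      exact this.hasFDerivAt.hasFDerivWithinAt)
    convex_univ (Set.mem_univ _) (Set.mem_univ _)
  rw [InnerProductSpace.toDual_apply_apply] at hc'
  have hcx : ‖x - c‖ ≤ ‖y - x‖ := by
    rw [norm_sub_rev x c, norm_sub_rev y x]
    obtain ⟨t, ht, rfl⟩ := segment_eq_image' ℝ x y ▸ hc
    rw [add_sub_cancel_left, norm_smul, norm_sub_rev x y, Real.norm_of_nonneg ht.1]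
    exact mul_le_of_le_one_left (norm_nonneg _) ht.2
  have h1 : inner ℝ (h x - h c) (y - x) ≤ L * ‖y - x‖ ^ 2 :=
    calc inner ℝ (h x - h c) (y - x) ≤ ‖h x - h c‖ * ‖y - x‖ := real_inner_le_norm _ _
      _ ≤ L * ‖y - x‖ * ‖y - x‖ := by
        gcongr
        exact (hL x c).trans (by gcongr)
      _ = L * ‖y - x‖ ^ 2 := by ring
  rw [inner_sub_left] at h1
  linarith

/-- Pathwise bound for a gradient ascent scheme perturbed by noise that is decomposed through a
Poisson equation: the increments are `h (x s) + w s - q s`, where `w s - p s` plays the role of a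
martingale difference and `p (s + 1) - q s` is controlled by the increment of the scheme. -/
theorem sum_mul_norm_sq_le_of_poisson {E : Type*} [NormedAddCommGroup E]
    [InnerProductSpace ℝ E] [CompleteSpace E] {V : E → ℝ} {h : E → E} {α : ℝ}
    (hV : Differentiable ℝ V) (hVh : ∀ x, gradient V x = h x)
    (hL : ∀ x y, ‖h x - h y‖ ≤ α * ‖x - y‖) (hα : 0 ≤ α) (hh : ∀ x, ‖h x‖ ≤ 3 * α)
    {γ : ℕ → ℝ} (hγ : ∀ s, 0 < γ (s + 1)) (hγm : ∀ s, γ (s + 2) ≤ γ (s + 1))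
    {x w p q : ℕ → E} (hx : ∀ s, x (s + 1) = x s + γ (s + 1) • (h (x s) + w s - q s))
    (hg : ∀ s, ‖h (x s) + w s - q s‖ ≤ α) (hp : ∀ s, ‖p s‖ ≤ α) (hq : ∀ s, ‖q s‖ ≤ α)
    (hpq : ∀ s, ‖p (s + 1) - q s‖ ≤ α * ‖x (s + 1) - x s‖) (t : ℕ) :
    ∑ s ∈ Finset.range (t + 1), γ (s + 1) * ‖h (x s)‖ ^ 2 ≤
      V (x (t + 1)) - V (x 0) + 6 * α ^ 2 * γ 1 +
        5 * α ^ 3 * ∑ s ∈ Finset.range (t + 1), γ (s + 1) ^ 2 -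
        ∑ s ∈ Finset.range (t + 1), γ (s + 1) * inner ℝ (h (x s)) (w s - p s) := by
  have hinc : ∀ s, ‖x (s + 1) - x s‖ ≤ α * γ (s + 1) := fun s => by
    rw [hx s, add_sub_cancel_left, norm_smul, Real.norm_of_nonneg (hγ s).le, mul_comm]
    exact mul_le_mul_of_nonneg_right (hg s) (hγ s).le
  have hbd : ∀ (y z : E), ‖z‖ ≤ α → |inner ℝ (h y) z| ≤ 3 * α ^ 2 := fun y z hz =>
    calc |inner ℝ (h y) z| ≤ ‖h y‖ * ‖z‖ := abs_real_inner_le_norm _ _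
      _ ≤ 3 * α * α := mul_le_mul (hh y) hz (norm_nonneg _) (by positivity)
      _ = 3 * α ^ 2 := by ring
  have hstep : ∀ s, γ (s + 1) * ‖h (x s)‖ ^ 2 ≤ V (x (s + 1)) - V (x s) +
      α ^ 3 * γ (s + 1) ^ 2 - γ (s + 1) * inner ℝ (h (x s)) (w s - p s) -
      γ (s + 1) * inner ℝ (h (x s)) (p s) + γ (s + 1) * inner ℝ (h (x s)) (q s) := fun s => by
    have h1 := add_inner_sub_le_of_gradient_lipschitz hV hVh hL hα (x s) (x (s + 1))
    have h2 : α * ‖x (s + 1) - x s‖ ^ 2 ≤ α * (α * γ (s + 1)) ^ 2 := by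
      gcongr
      exact hinc s
    have h3 : inner ℝ (h (x s)) (x (s + 1) - x s) = γ (s + 1) * (‖h (x s)‖ ^ 2 +
        inner ℝ (h (x s)) (w s) - inner ℝ (h (x s)) (q s)) := by
      rw [hx s, add_sub_cancel_left, inner_smul_right, inner_sub_right, inner_add_right,
        real_inner_self_eq_norm_sq]
    rw [inner_sub_right]
    linarith
  have hdrift : ∀ s, inner ℝ (h (x s)) (q s) - inner ℝ (h (x (s + 1))) (p (s + 1)) ≤
      4 * α ^ 3 * γ (s + 1) := fun s => by
    have h1 : -inner ℝ (h (x (s + 1)) - h (x s)) (p (s + 1)) ≤ α * (α * γ (s + 1)) * α :=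
      (neg_le_abs _).trans <| (abs_real_inner_le_norm _ _).trans <|
        mul_le_mul ((hL _ _).trans (mul_le_mul_of_nonneg_left (hinc s) hα)) (hp _)
          (norm_nonneg _) (by have := hγ s; positivity)
    have h2 : -inner ℝ (h (x s)) (p (s + 1) - q s) ≤ 3 * α * (α * (α * γ (s + 1))) :=
      (neg_le_abs _).trans <| (abs_real_inner_le_norm _ _).trans <|
        mul_le_mul (hh _) ((hpq s).trans (mul_le_mul_of_nonneg_left (hinc s) hα))
          (norm_nonneg _) (by positivity)
    rw [inner_sub_left] at h1
    rw [inner_sub_right] at h2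
    linarith
  have key : ∀ t, ∑ s ∈ Finset.range (t + 1), γ (s + 1) * ‖h (x s)‖ ^ 2 ≤
      V (x (t + 1)) - V (x 0) + α ^ 3 * ∑ s ∈ Finset.range (t + 1), γ (s + 1) ^ 2 +
        4 * α ^ 3 * ∑ s ∈ Finset.range t, γ (s + 1) ^ 2 -
        ∑ s ∈ Finset.range (t + 1), γ (s + 1) * inner ℝ (h (x s)) (w s - p s) +
        γ (t + 1) * inner ℝ (h (x t)) (q t) - γ 1 * inner ℝ (h (x 0)) (p 0) +
        3 * α ^ 2 * (γ 1 - γ (t + 1)) := by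
    intro t
    induction t with
    | zero =>
      have := hstep 0
      simp only [zero_add, Finset.range_one, Finset.sum_singleton, Finset.range_zero,
        Finset.sum_empty] at this ⊢
      linarith
    | succ t ih =>
      have h1 := hstep (t + 1)
      have h2 : γ (t + 2) * (inner ℝ (h (x t)) (q t) - inner ℝ (h (x (t + 1))) (p (t + 1))) ≤
          4 * α ^ 3 * γ (t + 1) ^ 2 :=
        calc _ ≤ γ (t + 2) * (4 * α ^ 3 * γ (t + 1)) :=
              mul_le_mul_of_nonneg_left (hdrift t) (hγ (t + 1)).le
          _ ≤ γ (t + 1) * (4 * α ^ 3 * γ (t + 1)) :=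
              mul_le_mul_of_nonneg_right (hγm t) (by have := hγ t; positivity)
          _ = _ := by ring
      have h3 : (γ (t + 1) - γ (t + 2)) * inner ℝ (h (x t)) (q t) ≤
          (γ (t + 1) - γ (t + 2)) * (3 * α ^ 2) :=
        mul_le_mul_of_nonneg_left ((le_abs_self _).trans (hbd _ _ (hq t)))
          (sub_nonneg.2 (hγm t))
      rw [Finset.sum_range_succ, Finset.sum_range_succ (fun s => γ (s + 1) ^ 2) (t + 1),
        Finset.sum_range_succ (fun s => γ (s + 1) ^ 2) t,
        Finset.sum_range_succ (fun s => γ (s + 1) * inner ℝ (h (x s)) (w s - p s)) (t + 1)]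
      rw [Finset.sum_range_succ (fun s => γ (s + 1) ^ 2) t] at ih
      simp only [add_assoc, one_add_one_eq_two] at h1 ih ⊢
      linarith
  have h1 : γ (t + 1) * inner ℝ (h (x t)) (q t) ≤ γ (t + 1) * (3 * α ^ 2) :=
    mul_le_mul_of_nonneg_left ((le_abs_self _).trans (hbd _ _ (hq t))) (hγ t).le
  have h2 : γ 1 * -inner ℝ (h (x 0)) (p 0) ≤ γ 1 * (3 * α ^ 2) :=
    mul_le_mul_of_nonneg_left ((neg_le_abs _).trans (hbd _ _ (hp 0))) (hγ 0).le
  have h3 : 4 * α ^ 3 * ∑ s ∈ Finset.range t, γ (s + 1) ^ 2 ≤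
      4 * α ^ 3 * ∑ s ∈ Finset.range (t + 1), γ (s + 1) ^ 2 := by
    rw [Finset.sum_range_succ]
    gcongr
    exact le_add_of_nonneg_right (sq_nonneg _)
  linarith [key t]

section Disintegration

variable {Ω X Z : Type*} {m m0 : MeasurableSpace Ω} [MeasurableSpace X] [MeasurableSpace Z]
  {μ : Measure Ω} [IsProbabilityMeasure μ] {κ : Ω → Measure Z} [∀ ω, IsProbabilityMeasure (κ ω)]
  {θ : Ω → X} {Y : Ω → Z}

/-- If `κ` is a conditional law of `Y` given `m`, tested on one set at a time, and `θ` is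
`m`-measurable, then the probability that `(θ, Y)` lies in `D` is the mean of the `κ`-measure of
the section of `D` at `θ`. The family `κ` need not be measurable. -/
theorem lintegral_section_eq_of_condExp_indicator (hm : m ≤ m0) (hθ : Measurable[m] θ)
    (hY : Measurable Y)
    (hκ : ∀ B, MeasurableSet B →
      μ[fun ω => B.indicator (1 : Z → ℝ) (Y ω)|m] =ᵐ[μ] fun ω => (κ ω).real B)
    {D : Set (X × Z)} (hD : MeasurableSet D) :
    AEMeasurable (fun ω => κ ω (Prod.mk (θ ω) ⁻¹' D)) μ ∧
      ∫⁻ ω, κ ω (Prod.mk (θ ω) ⁻¹' D) ∂μ = μ ((fun ω => (θ ω, Y ω)) ⁻¹' D) := by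
  have hθY : Measurable fun ω => (θ ω, Y ω) := (hθ.mono hm le_rfl).prodMk hY
  induction D, hD using MeasurableSpace.induction_on_inter generateFrom_prod.symm
    isPiSystem_prod with
  | empty => simp
  | basic D hD =>
    obtain ⟨A, hA, B, hB, rfl⟩ := hD
    have hae : AEMeasurable (fun ω => κ ω B) μ := by
      have h1 : AEMeasurable (fun ω => (κ ω).real B) μ :=
        ((stronglyMeasurable_condExp.mono hm).measurable.aemeasurable).congr (hκ B hB)
      refine h1.ennreal_ofReal.congr (.of_forall fun ω => ?_)
      simp
    have hsec : (fun ω => κ ω (Prod.mk (θ ω) ⁻¹' A ×ˢ B)) =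
        (θ ⁻¹' A).indicator fun ω => κ ω B := by
      ext ω
      by_cases hω : θ ω ∈ A <;> simp [Set.indicator, hω]
    have hA' : MeasurableSet[m] (θ ⁻¹' A) := hθ hA
    rw [hsec]
    refine ⟨hae.indicator (hm _ hA'), ?_⟩
    rw [lintegral_indicator (hm _ hA')]
    have hint : Integrable (fun ω => B.indicator (1 : Z → ℝ) (Y ω)) μ := by
      refine .of_bound ((measurable_one.indicator hB).comp hY).aestronglyMeasurable 1
        (.of_forall fun ω => ?_)
      by_cases hω : Y ω ∈ B <;> simp [hω]
    have h2 := setIntegral_condExp hm hint hA'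
    rw [setIntegral_congr_ae (hm _ hA') ((hκ B hB).mono fun ω h _ => h)] at h2
    have h3 : ∫ ω in θ ⁻¹' A, B.indicator (1 : Z → ℝ) (Y ω) ∂μ =
        μ.real ((fun ω => (θ ω, Y ω)) ⁻¹' A ×ˢ B) := by
      have : (fun ω => B.indicator (1 : Z → ℝ) (Y ω)) = (Y ⁻¹' B).indicator 1 := rfl
      rw [this, integral_indicator_one (hY hB), measureReal_restrict_apply (hY hB),
        Set.mk_preimage_prod, Set.inter_comm]
    simp only [measureReal_def] at h2 h3
    rw [h3, integral_toReal hae.restrict (.of_forall fun ω => measure_lt_top _ _)] at h2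
    refine (ENNReal.toReal_eq_toReal_iff' (ne_top_of_le_ne_top ENNReal.one_ne_top ?_)
      (measure_ne_top _ _)).1 h2
    calc ∫⁻ ω in θ ⁻¹' A, κ ω B ∂μ ≤ ∫⁻ _, 1 ∂μ :=
          (setLIntegral_le_lintegral _ _).trans (lintegral_mono fun ω => prob_le_one)
      _ = 1 := by simp
  | compl D hD ih =>
    have hsec : (fun ω => κ ω (Prod.mk (θ ω) ⁻¹' Dᶜ)) =
        fun ω => 1 - κ ω (Prod.mk (θ ω) ⁻¹' D) := by
      ext ω
      rw [Set.preimage_compl, prob_compl_eq_one_sub (measurable_prodMk_left hD)]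
    rw [hsec]
    refine ⟨aemeasurable_const.sub ih.1, ?_⟩
    rw [lintegral_sub' ih.1 (by rw [ih.2]; exact measure_ne_top _ _)
      (.of_forall fun ω => prob_le_one), ih.2, Set.preimage_compl,
      prob_compl_eq_one_sub (hθY hD)]
    simp
  | iUnion D hdisj hD ih =>
    have hsec : (fun ω => κ ω (Prod.mk (θ ω) ⁻¹' ⋃ i, D i)) =
        fun ω => ∑' i, κ ω (Prod.mk (θ ω) ⁻¹' D i) := by
      ext ω
      rw [Set.preimage_iUnion, measure_iUnion (fun i j hij => (hdisj hij).preimage _)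
        fun i => measurable_prodMk_left (hD i)]
    rw [hsec]
    refine ⟨AEMeasurable.tsum fun i => (ih i).1, ?_⟩
    rw [lintegral_tsum fun i => (ih i).1, Set.preimage_iUnion,
      measure_iUnion (fun i j hij => (hdisj hij).preimage _) fun i => hθY (hD i)]
    exact tsum_congr fun i => (ih i).2

/-- Tower property for a conditional law `κ` of `Y` given `m` that is only tested on one set at a
time: a nonnegative function of `(θ, Y)` with `θ` being `m`-measurable may be integrated against
`κ` first. -/
theorem lintegral_lintegral_eq_of_condExp_indicator (hm : m ≤ m0) (hθ : Measurable[m] θ)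
    (hY : Measurable Y)
    (hκ : ∀ B, MeasurableSet B →
      μ[fun ω => B.indicator (1 : Z → ℝ) (Y ω)|m] =ᵐ[μ] fun ω => (κ ω).real B)
    {F : X × Z → ENNReal} (hF : Measurable F) :
    AEMeasurable (fun ω => ∫⁻ z, F (θ ω, z) ∂κ ω) μ ∧
      ∫⁻ ω, ∫⁻ z, F (θ ω, z) ∂κ ω ∂μ = ∫⁻ ω, F (θ ω, Y ω) ∂μ := by
  have hθY : Measurable fun ω => (θ ω, Y ω) := (hθ.mono hm le_rfl).prodMk hY
  refine hF.ennreal_induction (motive := fun F =>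
    AEMeasurable (fun ω => ∫⁻ z, F (θ ω, z) ∂κ ω) μ ∧
      ∫⁻ ω, ∫⁻ z, F (θ ω, z) ∂κ ω ∂μ = ∫⁻ ω, F (θ ω, Y ω) ∂μ)
    (fun c D hD => ?_) (fun F G _ hF hG ihF ihG => ?_) fun F hF hmono ih => ?_
  · obtain ⟨h1, h2⟩ := lintegral_section_eq_of_condExp_indicator hm hθ hY hκ hD
    have hin : ∀ ω, ∫⁻ z, D.indicator (fun _ => c) (θ ω, z) ∂κ ω =
        c * κ ω (Prod.mk (θ ω) ⁻¹' D) := fun ω => by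
      rw [← lintegral_indicator_const (measurable_prodMk_left hD)]
      rfl
    simp_rw [hin]
    refine ⟨h1.const_mul c, ?_⟩
    rw [lintegral_const_mul'' c h1, h2, ← lintegral_indicator_const (hθY hD)]
    rfl
  · have hin : ∀ ω, ∫⁻ z, (F + G) (θ ω, z) ∂κ ω =
        ∫⁻ z, F (θ ω, z) ∂κ ω + ∫⁻ z, G (θ ω, z) ∂κ ω := fun ω =>
      lintegral_add_left (hF.comp measurable_prodMk_left) _
    simp_rw [hin]
    refine ⟨ihF.1.add ihG.1, ?_⟩
    rw [lintegral_add_left' ihF.1, ihF.2, ihG.2]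
    exact (lintegral_add_left (hF.comp hθY) _).symm
  · have hin : ∀ ω, ∫⁻ z, ⨆ n, F n (θ ω, z) ∂κ ω = ⨆ n, ∫⁻ z, F n (θ ω, z) ∂κ ω := fun ω =>
      lintegral_iSup (fun n => (hF n).comp measurable_prodMk_left) fun _ _ hij z => hmono hij _
    simp_rw [hin]
    refine ⟨AEMeasurable.iSup fun n => (ih n).1, ?_⟩
    rw [lintegral_iSup' (fun n => (ih n).1)
      (.of_forall fun ω _ _ hij => lintegral_mono fun z => hmono hij _)]
    exact (iSup_congr fun n => (ih n).2).trans
      (lintegral_iSup (fun n => (hF n).comp hθY) fun _ _ hij ω => hmono hij _).symm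

/-- Version of `lintegral_lintegral_eq_of_condExp_indicator` for bounded real functions. -/
theorem integral_integral_eq_of_condExp_indicator (hm : m ≤ m0) (hθ : Measurable[m] θ)
    (hY : Measurable Y)
    (hκ : ∀ B, MeasurableSet B →
      μ[fun ω => B.indicator (1 : Z → ℝ) (Y ω)|m] =ᵐ[μ] fun ω => (κ ω).real B)
    {F : X × Z → ℝ} (hF : Measurable F) {C : ℝ} (hC : ∀ y, |F y| ≤ C)
    (hm' : AEStronglyMeasurable (fun ω => ∫ z, F (θ ω, z) ∂κ ω) μ) :
    ∫ ω, ∫ z, F (θ ω, z) ∂κ ω ∂μ = ∫ ω, F (θ ω, Y ω) ∂μ := by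
  have hθY : Measurable fun ω => (θ ω, Y ω) := (hθ.mono hm le_rfl).prodMk hY
  have hpos : ∀ y, 0 ≤ F y + C := fun y => by linarith [neg_abs_le (F y), hC y]
  have hFi : ∀ ω, Integrable (fun z => F (θ ω, z)) (κ ω) := fun ω =>
    .of_bound (hF.comp measurable_prodMk_left).aestronglyMeasurable C (.of_forall fun z => hC _)
  have hin : ∀ ω, ∫⁻ z, ENNReal.ofReal (F (θ ω, z) + C) ∂κ ω =
      ENNReal.ofReal (∫ z, F (θ ω, z) ∂κ ω + C) := fun ω => by
    rw [← ofReal_integral_eq_lintegral_ofReal (f := fun z => F (θ ω, z) + C)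
      ((hFi ω).add (integrable_const C))
      (.of_forall fun z => hpos _), integral_add (hFi ω) (integrable_const C)]
    simp
  have hbd : ∀ ω, |∫ z, F (θ ω, z) ∂κ ω| ≤ C := fun ω => by
    simpa using norm_integral_le_of_norm_le_const (μ := κ ω) (f := fun z => F (θ ω, z))
      (.of_forall fun z => hC _)
  have hI : Integrable (fun ω => ∫ z, F (θ ω, z) ∂κ ω) μ :=
    .of_bound hm' C (.of_forall hbd)
  have hI' : Integrable (fun ω => F (θ ω, Y ω)) μ :=
    .of_bound (hF.comp hθY).aestronglyMeasurable C (.of_forall fun ω => hC _)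
  have h1 := (lintegral_lintegral_eq_of_condExp_indicator hm hθ hY hκ
    (F := fun y => ENNReal.ofReal (F y + C)) (hF.add_const C).ennreal_ofReal).2
  simp_rw [hin] at h1
  have hpos' : ∀ ω, 0 ≤ ∫ z, F (θ ω, z) ∂κ ω + C := fun ω => by
    linarith [neg_abs_le (∫ z, F (θ ω, z) ∂κ ω), hbd ω]
  rw [← ofReal_integral_eq_lintegral_ofReal (f := fun ω => ∫ z, F (θ ω, z) ∂κ ω + C)
      (hI.add (integrable_const C)) (.of_forall hpos'),
    ← ofReal_integral_eq_lintegral_ofReal (f := fun ω => F (θ ω, Y ω) + C)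
      (hI'.add (integrable_const C))
      (.of_forall fun ω => hpos _),
    ENNReal.ofReal_eq_ofReal_iff (integral_nonneg hpos') (integral_nonneg fun ω => hpos _),
    integral_add hI (integrable_const C), integral_add hI' (integrable_const C)] at h1
  exact add_right_cancel h1

end Disintegration

/-- (Main convergence theorem, Theorem 4.7.) For the
stochastic-approximation scheme `θ_{t+1} = θ_t + γ_{t+1} g(θ_t, Z_{t+1})` with
state-dependent Markov noise (conditionally on the past, `Z_{t+1} ∼ T_{θ_t}(Z_t, ·)`),
a bounded Lyapunov function `V` with `∇V = h`, a Poisson solution `hhat` with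
boundedness/Lipschitz constant `α̃`, and step sizes satisfying the stated
conditions, the weighted sums of squared mean-field norms satisfy
`∑_{s=0}^t γ_{s+1} E[‖h(θ_s)‖²] ≤ 2(E[V(θ_{t+1}) − V(θ_0)] + α̃(γ_1 − γ_{t+1} + 2)
+ (4α̃³ + c_γ) ∑_{s=0}^t γ_{s+1}²)`. -/
theorem ovsmc_main_convergence
    {Ω : Type*} [m0 : MeasurableSpace Ω] (μ : Measure Ω) [IsProbabilityMeasure μ]
    (ℱ : Filtration ℕ m0)
    {Z : Type*} [MeasurableSpace Z]
    (d : ℕ) (hd : 1 ≤ d)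
    (T : EuclideanSpace ℝ (Fin d) → Kernel Z Z) (hT : ∀ θ, IsMarkovKernel (T θ))
    (g : EuclideanSpace ℝ (Fin d) → Z → EuclideanSpace ℝ (Fin d))
    (hgm : Measurable (Function.uncurry g))
    (γ : ℕ → ℝ) (hγpos : ∀ t, 1 ≤ t → 0 < γ t)
    (Zp : ℕ → Ω → Z) (θp : ℕ → Ω → EuclideanSpace ℝ (Fin d))
    (hZad : ∀ t, Measurable[ℱ t] (Zp t))
    (hθad : ∀ t, Measurable[ℱ t] (θp t))
    (hupd : ∀ t ω, θp (t + 1) ω = θp t ω + γ (t + 1) • g (θp t ω) (Zp (t + 1) ω))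
    (hcond : ∀ (f : Z → ℝ), Measurable f → (∃ M, ∀ z, |f z| ≤ M) → ∀ t : ℕ,
      μ[fun ω => f (Zp (t + 1) ω)|ℱ t] =ᵐ[μ]
        fun ω => kernelOp (T (θp t ω)) f (Zp t ω))
    (h : EuclideanSpace ℝ (Fin d) → EuclideanSpace ℝ (Fin d))
    (V : EuclideanSpace ℝ (Fin d) → ℝ)
    (hVdiff : Differentiable ℝ V) (hVbd : ∃ M, ∀ θ, |V θ| ≤ M)
    (hVgrad : ∀ θ, gradient V θ = h θ)
    (αt : ℝ) (hαt : 1 ≤ αt)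
    (hhat : EuclideanSpace ℝ (Fin d) → Z → EuclideanSpace ℝ (Fin d))
    (hhhatm : Measurable (Function.uncurry hhat))
    (hpoisson : ∀ θ z, g θ z - h θ = hhat θ z - kernelOp (T θ) (hhat θ) z)
    (hbd1 : ∀ θ z, ‖g θ z‖ ≤ αt)
    (hbd2 : ∀ θ z, ‖hhat θ z‖ ≤ αt)
    (hbd3 : ∀ θ z, ‖kernelOp (T θ) (hhat θ) z‖ ≤ αt)
    (hlip1 : ∀ θ θ' z, ‖g θ z - g θ' z‖ ≤ αt * ‖θ - θ'‖)
    (hlip2 : ∀ θ θ' z,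
      ‖kernelOp (T θ) (hhat θ) z - kernelOp (T θ') (hhat θ') z‖ ≤ αt * ‖θ - θ'‖)
    (hlip3 : ∀ θ θ', ‖h θ - h θ'‖ ≤ αt * ‖θ - θ'‖)
    (a a' : ℝ) (ha : 0 < a) (ha' : 0 < a')
    (hγmono : ∀ t, 1 ≤ t → γ (t + 1) ≤ γ t)
    (hγa : ∀ t, 1 ≤ t → γ t ≤ a * γ (t + 1))
    (hγa' : ∀ t, 1 ≤ t → γ t - γ (t + 1) ≤ a' * γ (t + 1) ^ 2)
    (hγ1 : γ 1 ≤ 1 / (2 * αt + 2 * (αt * (a + 1) / 2 + αt ^ 2 * (2 * a + 1) + αt * a'))) :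
    ∀ t : ℕ,
      ∑ s ∈ Finset.range (t + 1), γ (s + 1) * ∫ ω, ‖h (θp s ω)‖ ^ 2 ∂μ ≤
        2 * ((∫ ω, (V (θp (t + 1) ω) - V (θp 0 ω)) ∂μ) +
          αt * (γ 1 - γ (t + 1) + 2) +
          (4 * αt ^ 3 + αt ^ 2 * (2 + αt)) *
            ∑ s ∈ Finset.range (t + 1), γ (s + 1) ^ 2) := by
  intro t
  have hα : 0 ≤ αt := by linarith
  have hP : ∀ θ z, kernelOp (T θ) (hhat θ) z = hhat θ z - g θ z + h θ := fun θ z => by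
    have := hpoisson θ z
    rw [sub_eq_iff_eq_add] at this
    rw [this]
    abel
  have hgeq : ∀ θ z, h θ + hhat θ z - kernelOp (T θ) (hhat θ) z = g θ z := fun θ z => by
    rw [hP]
    abel
  obtain ⟨ω₀⟩ : Nonempty Ω := μ.nonempty_of_neZero
  have hh : ∀ θ, ‖h θ‖ ≤ 3 * αt := fun θ => by
    have h1 : h θ = g θ (Zp 0 ω₀) - hhat θ (Zp 0 ω₀) +
        kernelOp (T θ) (hhat θ) (Zp 0 ω₀) := by
      rw [hP]
      abel
    rw [h1]
    linarith [norm_add_le (g θ (Zp 0 ω₀) - hhat θ (Zp 0 ω₀))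
      (kernelOp (T θ) (hhat θ) (Zp 0 ω₀)), norm_sub_le (g θ (Zp 0 ω₀)) (hhat θ (Zp 0 ω₀)),
      hbd1 θ (Zp 0 ω₀), hbd2 θ (Zp 0 ω₀), hbd3 θ (Zp 0 ω₀)]
  have hhm : Measurable h :=
    (LipschitzWith.of_dist_le_mul (K := ⟨αt, hα⟩) fun x y => by
      rw [dist_eq_norm, dist_eq_norm]; exact hlip3 x y).continuous.measurable
  have hPm : Measurable fun y : EuclideanSpace ℝ (Fin d) × Z =>
      kernelOp (T y.1) (hhat y.1) y.2 := by
    simp_rw [hP]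
    exact (hhhatm.sub hgm).add (hhm.comp measurable_fst)
  have hθm : ∀ s, Measurable (θp s) := fun s => (hθad s).mono (ℱ.le s) le_rfl
  have hZm : ∀ s, Measurable (Zp s) := fun s => (hZad s).mono (ℱ.le s) le_rfl
  have hinner : ∀ x y : EuclideanSpace ℝ (Fin d), ‖y‖ ≤ αt →
      |inner ℝ (h x) y| ≤ 3 * αt * αt := fun x y hy =>
    (abs_real_inner_le_norm _ _).trans
      (mul_le_mul (hh x) hy (norm_nonneg _) (by positivity))
  have hI1 : ∀ s, Integrable
      (fun ω => inner ℝ (h (θp s ω)) (hhat (θp s ω) (Zp (s + 1) ω))) μ := fun s =>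
    .of_bound ((hhm.comp (hθm s)).inner
      (hhhatm.comp ((hθm s).prodMk (hZm (s + 1))))).aestronglyMeasurable _
      (.of_forall fun ω => hinner _ _ (hbd2 _ _))
  have hI2 : ∀ s, Integrable (fun ω => inner ℝ (h (θp s ω))
      (kernelOp (T (θp s ω)) (hhat (θp s ω)) (Zp s ω))) μ := fun s =>
    .of_bound ((hhm.comp (hθm s)).inner
      (hPm.comp ((hθm s).prodMk (hZm s)))).aestronglyMeasurable _
      (.of_forall fun ω => hinner _ _ (hbd3 _ _))
  have hmart : ∀ s, ∫ ω, inner ℝ (h (θp s ω)) (hhat (θp s ω) (Zp (s + 1) ω) -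
      kernelOp (T (θp s ω)) (hhat (θp s ω)) (Zp s ω)) ∂μ = 0 := fun s => by
    simp_rw [inner_sub_right]
    rw [integral_sub (hI1 s) (hI2 s), sub_eq_zero]
    have hin : ∀ ω, ∫ z, inner ℝ (h (θp s ω)) (hhat (θp s ω) z) ∂(T (θp s ω) (Zp s ω)) =
        inner ℝ (h (θp s ω)) (kernelOp (T (θp s ω)) (hhat (θp s ω)) (Zp s ω)) := fun ω => by
      have := hT (θp s ω)
      exact integral_inner (.of_bound (hhhatm.comp measurable_prodMk_left).aestronglyMeasurable
        αt (.of_forall fun z => hbd2 _ _)) _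
    have := integral_integral_eq_of_condExp_indicator (μ := μ) (m := ℱ s)
      (κ := fun ω => T (θp s ω) (Zp s ω)) (ℱ.le s) (hθad s) (hZm (s + 1))
      (fun B hB => by
        refine (hcond (B.indicator 1) (measurable_one.indicator hB) ⟨1, fun z => ?_⟩ s).trans
          (.of_forall fun ω => integral_indicator_one hB)
        by_cases hz : z ∈ B <;> simp [hz])
      (F := fun y => inner ℝ (h y.1) (hhat y.1 y.2))
      ((hhm.comp measurable_fst).inner hhhatm) (fun y => hinner _ _ (hbd2 _ _))
      (by simpa only [hin] using (hI2 s).aestronglyMeasurable)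
    simp only [hin] at this
    exact this.symm
  have hγ0 : ∀ s, 0 < γ (s + 1) := fun s => hγpos _ (Nat.le_add_left 1 s)
  have hγm : ∀ s, γ (s + 2) ≤ γ (s + 1) := fun s => hγmono _ (Nat.le_add_left 1 s)
  have hpath := fun ω => sum_mul_norm_sq_le_of_poisson hVdiff hVgrad hlip3 hα hh hγ0 hγm
    (x := fun s => θp s ω) (w := fun s => hhat (θp s ω) (Zp (s + 1) ω))
    (p := fun s => kernelOp (T (θp s ω)) (hhat (θp s ω)) (Zp s ω))
    (q := fun s => kernelOp (T (θp s ω)) (hhat (θp s ω)) (Zp (s + 1) ω))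
    (fun s => by rw [hgeq, hupd]) (fun s => by rw [hgeq]; exact hbd1 _ _)
    (fun s => hbd3 _ _) (fun s => hbd3 _ _) (fun s => hlip2 _ _ _) t
  have hIh : ∀ s, Integrable (fun ω => γ (s + 1) * ‖h (θp s ω)‖ ^ 2) μ := fun s =>
    (Integrable.of_bound ((hhm.comp (hθm s)).norm.pow_const 2).aestronglyMeasurable
      ((3 * αt) ^ 2) (.of_forall fun ω => by
        rw [Real.norm_of_nonneg (sq_nonneg _)]
        exact pow_le_pow_left₀ (norm_nonneg _) (hh _) 2)).const_mul _
  obtain ⟨M, hM⟩ := hVbd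
  have hIV : ∀ s, Integrable (fun ω => V (θp s ω)) μ := fun s =>
    .of_bound (hVdiff.continuous.measurable.comp (hθm s)).aestronglyMeasurable M
      (.of_forall fun ω => hM _)
  have hIM : ∀ s, Integrable (fun ω => γ (s + 1) * inner ℝ (h (θp s ω))
      (hhat (θp s ω) (Zp (s + 1) ω) -
        kernelOp (T (θp s ω)) (hhat (θp s ω)) (Zp s ω))) μ := fun s => by
    simp_rw [inner_sub_right]
    exact ((hI1 s).sub (hI2 s)).const_mul _
  have hmean : ∑ s ∈ Finset.range (t + 1), γ (s + 1) * ∫ ω, ‖h (θp s ω)‖ ^ 2 ∂μ ≤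
      (∫ ω, (V (θp (t + 1) ω) - V (θp 0 ω)) ∂μ) + 6 * αt ^ 2 * γ 1 +
        5 * αt ^ 3 * ∑ s ∈ Finset.range (t + 1), γ (s + 1) ^ 2 := by
    have hIdV := (hIV (t + 1)).sub (hIV 0)
    have hIc : ∀ c : ℝ, Integrable (fun _ : Ω => c) μ := integrable_const
    have hIs := integrable_finsetSum (Finset.range (t + 1)) fun s _ => hIM s
    have := integral_mono (integrable_finsetSum (Finset.range (t + 1)) fun s _ => hIh s)
      (((hIdV.add (hIc _)).add (hIc _)).sub hIs) hpath
    rw [integral_finsetSum _ fun s _ => hIh s,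
      integral_sub' ((hIdV.add (hIc _)).add (hIc _)) hIs,
      integral_add' (hIdV.add (hIc _)) (hIc _), integral_add' hIdV (hIc _),
      integral_finsetSum _ fun s _ => hIM s] at this
    simp only [integral_const_mul, hmart, integral_const, probReal_univ, mul_zero,
      Finset.sum_const_zero, sub_zero, smul_eq_mul, one_mul] at this
    exact this
  have hpos : 0 ≤ ∑ s ∈ Finset.range (t + 1), γ (s + 1) * ∫ ω, ‖h (θp s ω)‖ ^ 2 ∂μ :=
    Finset.sum_nonneg fun s _ => mul_nonneg (hγ0 s).le (integral_nonneg fun ω => sq_nonneg _)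
  have hsq : 0 ≤ αt ^ 2 * ∑ s ∈ Finset.range (t + 1), γ (s + 1) ^ 2 := by positivity
  have hγt : γ (t + 1) ≤ γ 1 :=
    antitone_nat_of_succ_le (f := fun s => γ (s + 1)) hγm (Nat.zero_le t)
  have hαγ : 5 * αt * γ 1 ≤ 1 := by
    have h5 : 5 * αt ≤
        2 * αt + 2 * (αt * (a + 1) / 2 + αt ^ 2 * (2 * a + 1) + αt * a') := by
      have h1 : 0 ≤ αt * a := by positivity
      have h2 : 0 ≤ αt ^ 2 * a := by positivity
      have h3 : 0 ≤ αt * a' := by positivity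
      nlinarith
    rw [le_div_iff₀ (by linarith)] at hγ1
    nlinarith [hγ0 0]
  have hb : 6 * αt ^ 2 * γ 1 ≤ αt * (γ 1 - γ (t + 1) + 2) := by
    nlinarith [mul_le_mul_of_nonneg_left hαγ hα, mul_nonneg hα (sub_nonneg.2 hγt)]
  linarith
end
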